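/- Let (X, 𝒜, μ) be a probability space, let k ≥ 1 be an integer, and let f : X^k → ℝ be bounded and measurable. Then G_k(f) > 0 if and only if the conditional expectation 𝔼(f | 𝓑_{k,k−1}) (with respect to μ^{⊗k}) has positive L²-norm, i.e., is not equal to 0 μ^{⊗k}-almost everywhere. -/

import Mathlib

open MeasureTheory

/-- The Gowers box expression
`G_k(f) = ∫ ∏_{ω ∈ {0,1}^k} f(h^{ω(1)}_1, …, h^{ω(k)}_k) d(μ^⊗k ⊗ μ^⊗k)(h⁰, h¹)`,
the `2^k`-th power of the `k`-th Gowers uniformity seminorm of `f`. -/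
noncomputable def gowersBox {X : Type*} [MeasurableSpace X] (μ : Measure X) (k : ℕ)
    (f : (Fin k → X) → ℝ) : ℝ :=
  ∫ h : (Fin k → X) × (Fin k → X),
    ∏ ω : Fin k → Bool, f (fun i => if ω i then h.2 i else h.1 i)
    ∂((Measure.pi fun _ => μ).prod (Measure.pi fun _ => μ))

/-- The σ-algebra `𝓑_{k,k-1}` on `X^k`: the σ-algebra generated by the preimages of
measurable sets under the coordinate projections `π_I : X^k → X^I`, as `I` ranges over the
`(k-1)`-element subsets of the coordinates. -/
def boxSigmaAlgebra (X : Type*) [MeasurableSpace X] (k : ℕ) :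
    MeasurableSpace (Fin k → X) :=
  MeasurableSpace.generateFrom
    {A | ∃ I : Finset (Fin k), I.card = k - 1 ∧
      ∃ S : Set (↥I → X), MeasurableSet S ∧
        A = (fun (h : Fin k → X) (i : ↥I) => h i.1) ⁻¹' S}

/-- Measurable real functions that are bounded in absolute value. -/
def IsBoundedMeasurable {α : Type*} [MeasurableSpace α] (f : α → ℝ) : Prop :=
  Measurable f ∧ ∃ C : ℝ, ∀ x, |f x| ≤ C

namespace IsBoundedMeasurable

variable {α β : Type*} [MeasurableSpace α] [MeasurableSpace β] {f g : α → ℝ}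

theorem mul (hf : IsBoundedMeasurable f) (hg : IsBoundedMeasurable g) :
    IsBoundedMeasurable fun x => f x * g x := by
  obtain ⟨hf, C, hC⟩ := hf
  obtain ⟨hg, D, hD⟩ := hg
  refine ⟨hf.mul hg, C * D, fun x => ?_⟩
  rw [abs_mul]
  exact mul_le_mul (hC x) (hD x) (abs_nonneg _) ((abs_nonneg _).trans (hC x))

theorem const (c : ℝ) : IsBoundedMeasurable fun _ : α => c :=
  ⟨measurable_const, |c|, fun _ => le_rfl⟩

theorem prod {ι : Type*} (s : Finset ι) {F : ι → α → ℝ}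
    (hF : ∀ i ∈ s, IsBoundedMeasurable (F i)) :
    IsBoundedMeasurable fun x => ∏ i ∈ s, F i x := by
  classical
  induction s using Finset.induction_on with
  | empty => simpa using const 1
  | insert a s ha ih =>
    simp only [Finset.prod_insert ha]
    exact (hF a (Finset.mem_insert_self a s)).mul
      (ih fun i hi => hF i (Finset.mem_insert_of_mem hi))

theorem pow (hf : IsBoundedMeasurable f) (n : ℕ) : IsBoundedMeasurable fun x => f x ^ n := by
  simpa using prod (Finset.range n) (F := fun _ => f) fun _ _ => hf

theorem comp (hf : IsBoundedMeasurable f) {φ : β → α} (hφ : Measurable φ) :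
    IsBoundedMeasurable fun y => f (φ y) :=
  ⟨hf.1.comp hφ, hf.2.imp fun _ hC y => hC (φ y)⟩

theorem integrable (hf : IsBoundedMeasurable f) (μ : Measure α) [IsFiniteMeasure μ] :
    Integrable f μ := by
  obtain ⟨hf, C, hC⟩ := hf
  exact Integrable.of_bound hf.aestronglyMeasurable C (ae_of_all _ hC)

theorem integral_right {F : α × β → ℝ} (hF : IsBoundedMeasurable F) (ν : Measure β)
    [IsProbabilityMeasure ν] : IsBoundedMeasurable fun x => ∫ y, F (x, y) ∂ν := by
  obtain ⟨hF, C, hC⟩ := hF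
  refine ⟨hF.stronglyMeasurable.integral_prod_right'.measurable, C, fun x => ?_⟩
  simpa using norm_integral_le_of_norm_le_const (μ := ν) (f := fun y => F (x, y)) (C := C)
    (ae_of_all _ fun y => hC (x, y))

/-- Jensen's inequality for the convex functions `t ↦ t ^ 2 ^ k`. -/
theorem integral_pow_two_pow_le (hf : IsBoundedMeasurable f) (μ : Measure α)
    [IsProbabilityMeasure μ] (k : ℕ) : (∫ x, f x ∂μ) ^ 2 ^ k ≤ ∫ x, f x ^ 2 ^ k ∂μ := by
  have hconv : ConvexOn ℝ Set.univ fun t : ℝ => t ^ 2 ^ k := by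
    cases k with
    | zero => simpa using! convexOn_id (𝕜 := ℝ) (β := ℝ) convex_univ
    | succ k => exact Even.convexOn_pow ⟨2 ^ k, by ring⟩
  exact hconv.map_integral_le (by fun_prop) isClosed_univ (by simp) (hf.integrable μ)
    ((hf.pow _).integrable μ)

end IsBoundedMeasurable

section Box

variable {X : Type*} [MeasurableSpace X]

theorem measurable_finCons {k : ℕ} :
    Measurable fun p : X × (Fin k → X) => (Fin.cons p.1 p.2 : Fin (k + 1) → X) := by
  refine measurable_pi_iff.2 fun i => ?_
  refine Fin.cases ?_ (fun j => ?_) i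
  · simpa using measurable_fst
  · simp only [Fin.cons_succ]; fun_prop

theorem integral_pi_finCons (μ : Measure X) [IsProbabilityMeasure μ] {k : ℕ}
    (F : (Fin (k + 1) → X) → ℝ) :
    ∫ z, F z ∂(Measure.pi fun _ => μ) =
      ∫ p : X × (Fin k → X), F (Fin.cons p.1 p.2) ∂(μ.prod (Measure.pi fun _ => μ)) := by
  have h := (measurePreserving_piFinSuccAbove (fun _ : Fin (k + 1) => μ) 0).symm
  rw [← h.integral_comp (MeasurableEquiv.measurableEmbedding _)]
  refine integral_congr_ae (ae_of_all _ fun p => congrArg F ?_)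
  exact Fin.insertNth_zero' p.1 p.2

theorem measurable_finMix {k : ℕ} (ω : Fin k → Bool) :
    Measurable fun h : (Fin k → X) × (Fin k → X) =>
      fun i => if ω i then h.2 i else h.1 i := by
  refine measurable_pi_iff.2 fun i => ?_
  by_cases hω : ω i <;> simp only [hω] <;> simp <;> fun_prop

theorem isBoundedMeasurable_boxProd {k : ℕ} {f : (Fin k → X) → ℝ} (hf : IsBoundedMeasurable f) :
    IsBoundedMeasurable fun h : (Fin k → X) × (Fin k → X) =>
      ∏ ω : Fin k → Bool, f (fun i => if ω i then h.2 i else h.1 i) :=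
  .prod _ fun ω _ => hf.comp (measurable_finMix ω)

theorem gowersBox_succ (μ : Measure X) [IsProbabilityMeasure μ] {k : ℕ}
    {f : (Fin (k + 1) → X) → ℝ} (hf : IsBoundedMeasurable f) :
    gowersBox μ (k + 1) f =
      ∫ p : X × X, gowersBox μ k (fun y => f (Fin.cons p.1 y) * f (Fin.cons p.2 y))
        ∂(μ.prod μ) := by
  have hB := isBoundedMeasurable_boxProd hf
  have hprod (x x' : X) (y y' : Fin k → X) :
      (∏ ω : Fin (k + 1) → Bool, f (fun i => if ω i then (Fin.cons x' y' : Fin (k + 1) → X) i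
        else (Fin.cons x y : Fin (k + 1) → X) i)) =
      ∏ ω : Fin k → Bool, f (Fin.cons x fun i => if ω i then y' i else y i) *
        f (Fin.cons x' fun i => if ω i then y' i else y i) := by
    rw [← (Fin.consEquiv fun _ => Bool).prod_comp, Fintype.prod_prod_type, Fintype.prod_bool,
      mul_comm, ← Finset.prod_mul_distrib]
    refine Finset.prod_congr rfl fun ω _ => ?_
    congr 2 <;> · funext i; refine Fin.cases ?_ (fun j => ?_) i <;> simp [Fin.consEquiv]
  have hm : Measurable fun q : (X × X) × ((Fin k → X) × (Fin k → X)) =>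
      ((Fin.cons q.1.1 q.2.1 : Fin (k + 1) → X), (Fin.cons q.1.2 q.2.2 : Fin (k + 1) → X)) :=
    (measurable_finCons.comp (by fun_prop : Measurable fun q :
      (X × X) × ((Fin k → X) × (Fin k → X)) => (q.1.1, q.2.1))).prodMk
    (measurable_finCons.comp (by fun_prop : Measurable fun q :
      (X × X) × ((Fin k → X) × (Fin k → X)) => (q.1.2, q.2.2)))
  have hQ := hB.comp hm
  simp only [hprod] at hQ
  unfold gowersBox
  rw [integral_prod _ (hB.integrable _), integral_pi_finCons]
  simp only [integral_pi_finCons, hprod]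
  have hQ₁ : IsBoundedMeasurable fun q : (X × (Fin k → X)) × (X × (Fin k → X)) =>
      ∏ ω : Fin k → Bool, f (Fin.cons q.1.1 fun i => if ω i then q.2.2 i else q.1.2 i) *
        f (Fin.cons q.2.1 fun i => if ω i then q.2.2 i else q.1.2 i) :=
    hQ.comp (φ := fun q : (X × (Fin k → X)) × (X × (Fin k → X)) =>
      ((q.1.1, q.2.1), (q.1.2, q.2.2))) (by fun_prop)
  rw [integral_prod _ ((hQ₁.integral_right _).integrable _)]
  rw [integral_prod _ ((hQ.integral_right _).integrable _)]
  refine integral_congr_ae (ae_of_all _ fun x => ?_)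
  have hx₁ : IsBoundedMeasurable fun q : (Fin k → X) × (X × (Fin k → X)) =>
      ∏ ω : Fin k → Bool, f (Fin.cons x fun i => if ω i then q.2.2 i else q.1 i) *
        f (Fin.cons q.2.1 fun i => if ω i then q.2.2 i else q.1 i) :=
    hQ₁.comp (φ := fun q : (Fin k → X) × (X × (Fin k → X)) => ((x, q.1), q.2)) (by fun_prop)
  have hx₂ : IsBoundedMeasurable fun q : X × ((Fin k → X) × (Fin k → X)) =>
      ∏ ω : Fin k → Bool, f (Fin.cons x fun i => if ω i then q.2.2 i else q.2.1 i) *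
        f (Fin.cons q.1 fun i => if ω i then q.2.2 i else q.2.1 i) :=
    hQ.comp (φ := fun q : X × ((Fin k → X) × (Fin k → X)) => ((x, q.1), q.2)) (by fun_prop)
  dsimp only
  rw [integral_integral_swap (hx₁.integrable _)]
  have hx₃ : IsBoundedMeasurable fun q : (X × (Fin k → X)) × (Fin k → X) =>
      ∏ ω : Fin k → Bool, f (Fin.cons x fun i => if ω i then q.1.2 i else q.2 i) *
        f (Fin.cons q.1.1 fun i => if ω i then q.1.2 i else q.2 i) :=
    hx₁.comp measurable_swap
  rw [integral_prod _ ((hx₃.integral_right _).integrable _)]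
  refine integral_congr_ae (ae_of_all _ fun x' => ?_)
  have hxx : IsBoundedMeasurable fun q : (Fin k → X) × (Fin k → X) =>
      ∏ ω : Fin k → Bool, f (Fin.cons x fun i => if ω i then q.2 i else q.1 i) *
        f (Fin.cons x' fun i => if ω i then q.2 i else q.1 i) :=
    hx₂.comp (φ := fun q : (Fin k → X) × (Fin k → X) => (x', q)) (by fun_prop)
  exact (integral_prod_symm _ (hxx.integrable _)).symm

/-- The Gowers–Cauchy–Schwarz inequality against a product of functions `g i`, bounded by `1` and
independent of the `i`-th coordinate. -/
theorem integral_mul_prod_pow_le_gowersBox (μ : Measure X) [IsProbabilityMeasure μ] (k : ℕ)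
    {f : (Fin k → X) → ℝ} (hf : IsBoundedMeasurable f) {g : Fin k → (Fin k → X) → ℝ}
    (hg : ∀ i, Measurable (g i)) (hg₁ : ∀ i x, |g i x| ≤ 1)
    (hgi : ∀ i x a, g i (Function.update x i a) = g i x) :
    (∫ x, f x * ∏ i, g i x ∂(Measure.pi fun _ => μ)) ^ 2 ^ k ≤ gowersBox μ k f := by
  induction k with
  | zero =>
    have hc (x : Fin 0 → X) : f x = f default := congrArg f (Subsingleton.elim _ _)
    unfold gowersBox
    simp [hc]
  | succ k ih =>
    let ν : Measure (Fin k → X) := Measure.pi fun _ => μ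
    have hgb (i) : IsBoundedMeasurable (g i) := ⟨hg i, 1, hg₁ i⟩
    let K : X × (Fin k → X) → ℝ := fun p =>
      f (Fin.cons p.1 p.2) * ∏ i : Fin k, g i.succ (Fin.cons p.1 p.2)
    have hK : IsBoundedMeasurable K :=
      (hf.mul (.prod _ fun i _ => hgb (Fin.succ i))).comp measurable_finCons
    obtain ⟨x₀⟩ : Nonempty X := nonempty_of_isProbabilityMeasure μ
    let G : (Fin k → X) → ℝ := fun y => g 0 (Fin.cons x₀ y)
    have hGx (x y) : g 0 (Fin.cons x y) = G y := by
      simpa [G] using hgi 0 (Fin.cons x₀ y) x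
    have hG : IsBoundedMeasurable G :=
      (hgb 0).comp (measurable_finCons.comp (by fun_prop : Measurable fun y => (x₀, y)))
    let H : (Fin k → X) → ℝ := fun y => ∫ x, K (x, y) ∂μ
    have hH : IsBoundedMeasurable H := (hK.comp measurable_swap).integral_right μ
    let I : X × X → ℝ := fun p => ∫ y, K (p.1, y) * K (p.2, y) ∂ν
    have hKK : IsBoundedMeasurable fun q : (X × X) × (Fin k → X) =>
        K (q.1.1, q.2) * K (q.1.2, q.2) :=
      (hK.comp (φ := fun q : (X × X) × (Fin k → X) => (q.1.1, q.2)) (by fun_prop)).mul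
        (hK.comp (φ := fun q : (X × X) × (Fin k → X) => (q.1.2, q.2)) (by fun_prop))
    have hI : IsBoundedMeasurable I := hKK.integral_right ν
    have h₁ : ∫ x, f x * ∏ i, g i x ∂(Measure.pi fun _ => μ) = ∫ y, G y * H y ∂ν := by
      have he (p : X × (Fin k → X)) : f (Fin.cons p.1 p.2) * ∏ i, g i (Fin.cons p.1 p.2) =
          G p.2 * K p := by
        rw [Fin.prod_univ_succ, hGx]; ring
      rw [integral_pi_finCons]
      simp only [he]
      rw [integral_prod_symm _ (((hG.comp measurable_snd).mul hK).integrable _)]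
      simp only [integral_const_mul, H, ν]
    have h₂ : (∫ y, G y * H y ∂ν) ^ 2 ≤ ∫ p, I p ∂(μ.prod μ) := by
      calc (∫ y, G y * H y ∂ν) ^ 2 ≤ ∫ y, (G y * H y) ^ 2 ∂ν := by
            simpa using (hG.mul hH).integral_pow_two_pow_le ν 1
        _ ≤ ∫ y, H y ^ 2 ∂ν := by
            refine integral_mono (((hG.mul hH).pow 2).integrable _) ((hH.pow 2).integrable _)
              fun y => ?_
            have : G y ^ 2 ≤ 1 := (sq_le_one_iff_abs_le_one _).2 (hg₁ _ _)
            change (G y * H y) ^ 2 ≤ H y ^ 2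
            nlinarith [sq_nonneg (H y)]
        _ = ∫ y, ∫ p : X × X, K (p.1, y) * K (p.2, y) ∂(μ.prod μ) ∂ν := by
            refine integral_congr_ae (ae_of_all _ fun y => ?_)
            simp only [H, sq]
            exact (integral_prod_mul (fun x => K (x, y)) (fun x => K (x, y))).symm
        _ = ∫ p, I p ∂(μ.prod μ) :=
            integral_integral_swap ((hKK.comp measurable_swap).integrable _)
    have h₃ (p : X × X) : I p ^ 2 ^ k ≤
        gowersBox μ k (fun y => f (Fin.cons p.1 y) * f (Fin.cons p.2 y)) := by
      have hc (x : X) : Measurable fun y : Fin k → X => (Fin.cons x y : Fin (k + 1) → X) :=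
        measurable_finCons.comp (by fun_prop : Measurable fun y => (x, y))
      have := ih ((hf.comp (hc p.1)).mul (hf.comp (hc p.2)))
        (g := fun i y => g i.succ (Fin.cons p.1 y) * g i.succ (Fin.cons p.2 y))
        (fun i => ((hg i.succ).comp (hc p.1)).mul ((hg i.succ).comp (hc p.2)))
        (fun i y => by
          rw [abs_mul]
          exact mul_le_one₀ (hg₁ _ _) (abs_nonneg _) (hg₁ _ _))
        (fun i y a => by simp only [Fin.cons_update, hgi])
      convert this using 3
      funext y
      simp only [K, Finset.prod_mul_distrib]
      ring
    have hbox : IsBoundedMeasurable fun p : X × X =>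
        gowersBox μ k (fun y => f (Fin.cons p.1 y) * f (Fin.cons p.2 y)) := by
      unfold gowersBox
      refine IsBoundedMeasurable.integral_right (F := fun q : (X × X) × ((Fin k → X) × (Fin k → X)) =>
        ∏ ω : Fin k → Bool, f (Fin.cons q.1.1 fun i => if ω i then q.2.2 i else q.2.1 i) *
          f (Fin.cons q.1.2 fun i => if ω i then q.2.2 i else q.2.1 i)) ?_ _
      refine .prod _ fun ω _ => .mul (hf.comp ?_) (hf.comp ?_)
      · exact measurable_finCons.comp
          (measurable_fst.fst.prodMk ((measurable_finMix ω).comp measurable_snd))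
      · exact measurable_finCons.comp
          (measurable_fst.snd.prodMk ((measurable_finMix ω).comp measurable_snd))
    rw [h₁, pow_succ', pow_mul, gowersBox_succ μ hf]
    calc ((∫ y, G y * H y ∂ν) ^ 2) ^ 2 ^ k ≤ (∫ p, I p ∂(μ.prod μ)) ^ 2 ^ k :=
          pow_le_pow_left₀ (sq_nonneg _) h₂ _
      _ ≤ ∫ p, I p ^ 2 ^ k ∂(μ.prod μ) := hI.integral_pow_two_pow_le _ k
      _ ≤ _ := integral_mono ((hI.pow _).integrable _) (hbox.integrable _) h₃

theorem boxSigmaAlgebra_le (k : ℕ) : boxSigmaAlgebra X k ≤ MeasurableSpace.pi := by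
  refine MeasurableSpace.generateFrom_le ?_
  rintro _ ⟨I, -, S, hS, rfl⟩
  exact measurableSet_preimage (by fun_prop) hS

/-- A measurable function that ignores one coordinate is measurable for `boxSigmaAlgebra`. -/
theorem measurable_boxSigmaAlgebra_of_update {β : Type*} [MeasurableSpace β] {k : ℕ}
    {g : (Fin k → X) → β} (hg : Measurable g) (i : Fin k)
    (hgi : ∀ x a, g (Function.update x i a) = g x) : Measurable[boxSigmaAlgebra X k] g := by
  classical
  intro T hT
  rcases isEmpty_or_nonempty X with hX | ⟨⟨a₀⟩⟩
  · have : IsEmpty (Fin k → X) := ⟨fun x => hX.elim (x i)⟩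
    rw [Set.eq_empty_of_isEmpty (g ⁻¹' T)]
    exact @MeasurableSet.empty _ (boxSigmaAlgebra X k)
  let e : (↥(Finset.univ.erase i) → X) → Fin k → X := fun z j =>
    if h : j ∈ Finset.univ.erase i then z ⟨j, h⟩ else a₀
  have he : Measurable e := by
    refine measurable_pi_iff.2 fun j => ?_
    by_cases h : j ∈ Finset.univ.erase i
    · simpa only [e, h, dite_true] using measurable_pi_apply _
    · simpa only [e, h, dite_false] using measurable_const
  refine MeasurableSpace.measurableSet_generateFrom
    ⟨Finset.univ.erase i, by simp [Finset.card_erase_of_mem], e ⁻¹' (g ⁻¹' T), he (hg hT), ?_⟩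
  ext x
  have hx : e (fun j => x j.1) = Function.update x i a₀ := by
    funext j
    by_cases h : j = i
    · subst h; simp [e]
    · simp [e, h]
  simp only [Set.mem_preimage]
  rw [hx, hgi]

/-- The intersections of one measurable set ignoring the `i`-th coordinate for each `i`. -/
def boxCylinders (X : Type*) [MeasurableSpace X] (k : ℕ) : Set (Set (Fin k → X)) :=
  {A | ∃ S : Fin k → Set (Fin k → X), (∀ i, MeasurableSet (S i)) ∧
    (∀ i x a, Function.update x i a ∈ S i ↔ x ∈ S i) ∧ A = ⋂ i, S i}

theorem isPiSystem_boxCylinders (k : ℕ) : IsPiSystem (boxCylinders X k) := by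
  rintro _ ⟨S, hS, hSi, rfl⟩ _ ⟨T, hT, hTi, rfl⟩ -
  exact ⟨fun i => S i ∩ T i, fun i => (hS i).inter (hT i),
    fun i x a => and_congr (hSi i x a) (hTi i x a), (Set.iInter_inter_distrib S T).symm⟩

theorem univ_mem_boxCylinders (k : ℕ) : Set.univ ∈ boxCylinders X k :=
  ⟨fun _ => Set.univ, fun _ => .univ, by simp, by simp⟩

theorem boxSigmaAlgebra_eq_generateFrom_boxCylinders {k : ℕ} (hk : 1 ≤ k) :
    boxSigmaAlgebra X k = MeasurableSpace.generateFrom (boxCylinders X k) := by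
  classical
  refine le_antisymm (MeasurableSpace.generateFrom_le ?_) (MeasurableSpace.generateFrom_le ?_)
  · rintro _ ⟨I, hI, S, hS, rfl⟩
    obtain ⟨i, hi⟩ : ∃ i, i ∉ I := by
      by_contra! h
      have : I.card = k := by simp [Finset.eq_univ_of_forall h]
      omega
    refine MeasurableSpace.measurableSet_generateFrom
      ⟨fun j => if j = i then (fun (h : Fin k → X) (i : ↥I) => h i.1) ⁻¹' S else Set.univ,
        fun j => ?_, fun j x a => ?_, ?_⟩
    · dsimp only
      split_ifs
      · exact measurableSet_preimage (by fun_prop) hS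
      · exact .univ
    · dsimp only
      split_ifs with h
      · subst h
        have : (fun l : ↥I => Function.update x j a l.1) = fun l : ↥I => x l.1 := by
          funext l
          exact Function.update_of_ne (fun h : l.1 = j => hi (h ▸ l.2)) _ _
        simp only [Set.mem_preimage, this]
      · simp
    · ext x
      simp only [Set.mem_iInter]
      refine ⟨fun hx j => ?_, fun hx => by simpa using hx i⟩
      split_ifs
      · exact hx
      · trivial
  · rintro _ ⟨S, hS, hSi, rfl⟩
    refine @MeasurableSet.iInter _ _ (boxSigmaAlgebra X k) _ _ fun i => ?_
    have := measurable_boxSigmaAlgebra_of_update (g := fun x => x ∈ S i) (hS i).mem i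
      fun x a => propext (hSi i x a)
    simpa using this (measurableSet_singleton True)

theorem gowersBox_eq_zero_of_condExp_eq_zero (μ : Measure X) [IsProbabilityMeasure μ] {k : ℕ}
    {f : (Fin k → X) → ℝ} (hf : IsBoundedMeasurable f)
    (h : (Measure.pi fun _ => μ)[f|boxSigmaAlgebra X k] =ᵐ[(Measure.pi fun _ => μ)]
      (0 : (Fin k → X) → ℝ)) : gowersBox μ k f = 0 := by
  classical
  let ν : Measure (Fin k → X) := Measure.pi fun _ => μ
  unfold gowersBox
  rw [integral_prod_symm _ ((isBoundedMeasurable_boxProd hf).integrable _)]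
  refine integral_eq_zero_of_ae (ae_of_all _ fun y => ?_)
  let g : (Fin k → X) → ℝ := fun x =>
    ∏ ω ∈ Finset.univ.erase (fun _ : Fin k => false), f (fun i => if ω i then y i else x i)
  have hmix (ω : Fin k → Bool) : Measurable fun x : Fin k → X =>
      fun i => if ω i then y i else x i :=
    (measurable_finMix ω).comp (measurable_id.prodMk measurable_const)
  have hg : IsBoundedMeasurable g := .prod _ fun ω _ => hf.comp (hmix ω)
  have hgm : Measurable[boxSigmaAlgebra X k] g := by
    refine Finset.measurable_prod _ fun ω hω => ?_
    obtain ⟨i, hi⟩ : ∃ i, ω i = true := by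
      by_contra! hc
      exact (Finset.mem_erase.1 hω).1 (funext fun i => by simpa using hc i)
    refine measurable_boxSigmaAlgebra_of_update (hf.1.comp (hmix ω)) i fun x a => ?_
    refine congrArg f ?_
    funext j
    by_cases hj : j = i
    · subst hj; simp [hi]
    · simp [hj]
  have hfg : (fun x => ∏ ω : Fin k → Bool, f (fun i => if ω i then y i else x i)) = f * g := by
    funext x
    rw [Pi.mul_apply, ← Finset.mul_prod_erase _ _ (Finset.mem_univ fun _ : Fin k => false)]
    simp [g]
  change ∫ x, (fun x => ∏ ω : Fin k → Bool, f (fun i => if ω i then y i else x i)) x ∂ν = 0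
  rw [hfg, ← integral_condExp (boxSigmaAlgebra_le k)]
  refine integral_eq_zero_of_ae ?_
  filter_upwards [condExp_mul_of_stronglyMeasurable_right (μ := ν) hgm.stronglyMeasurable
    ((hf.mul hg).integrable ν) (hf.integrable ν), h] with x h₁ h₂
  rw [h₁, Pi.mul_apply, h₂]
  simp

theorem setIntegral_boxCylinders_eq_zero (μ : Measure X) [IsProbabilityMeasure μ] {k : ℕ}
    {f : (Fin k → X) → ℝ} (hf : IsBoundedMeasurable f) (h : gowersBox μ k f ≤ 0)
    (hk : 1 ≤ k) {A : Set (Fin k → X)} (hA : A ∈ boxCylinders X k) :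
    ∫ x in A, f x ∂(Measure.pi fun _ => μ) = 0 := by
  classical
  obtain ⟨S, hS, hSi, rfl⟩ := hA
  have key := integral_mul_prod_pow_le_gowersBox μ k hf
    (g := fun i => (S i).indicator fun _ => 1) (fun i => measurable_const.indicator (hS i))
    (fun i x => by by_cases hx : x ∈ S i <;> simp [hx])
    (fun i x a => by simp only [Set.indicator_apply, hSi i x a])
  rw [← integral_indicator (MeasurableSet.iInter hS)]
  have he : (⋂ i, S i).indicator f = fun x => f x * ∏ i, (S i).indicator (fun _ => (1 : ℝ)) x := by
    funext x
    by_cases hx : ∀ i, x ∈ S i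
    · simp [hx]
    · obtain ⟨i, hi⟩ := not_forall.1 hx
      rw [Finset.prod_eq_zero (Finset.mem_univ i) (by simp [hi]), mul_zero,
        Set.indicator_of_notMem (by simpa using hx)]
  rw [he]
  have heven : Even (2 ^ k) := (Nat.even_pow' (by omega)).2 even_two
  exact eq_zero_of_pow_eq_zero (le_antisymm (key.trans h) (heven.pow_nonneg _))

theorem condExp_eq_zero_of_gowersBox_nonpos (μ : Measure X) [IsProbabilityMeasure μ] {k : ℕ}
    (hk : 1 ≤ k) {f : (Fin k → X) → ℝ} (hf : IsBoundedMeasurable f) (h : gowersBox μ k f ≤ 0) :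
    (Measure.pi fun _ => μ)[f|boxSigmaAlgebra X k] =ᵐ[(Measure.pi fun _ => μ)]
      (0 : (Fin k → X) → ℝ) := by
  let ν : Measure (Fin k → X) := Measure.pi fun _ => μ
  have hle := boxSigmaAlgebra_le (X := X) k
  have hfi : Integrable f ν := hf.integrable ν
  have hset : ∀ A, MeasurableSet[boxSigmaAlgebra X k] A → ∫ x in A, f x ∂ν = 0 := by
    intro A hA
    induction A, hA using MeasurableSpace.induction_on_inter
      (boxSigmaAlgebra_eq_generateFrom_boxCylinders hk) (isPiSystem_boxCylinders k) with
    | empty => simp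
    | basic t ht => exact setIntegral_boxCylinders_eq_zero μ hf h hk ht
    | compl t ht ih =>
      have huniv := setIntegral_boxCylinders_eq_zero μ hf h hk (univ_mem_boxCylinders k)
      rw [setIntegral_univ] at huniv
      have := integral_add_compl (hle t ht) hfi
      rw [ih, zero_add] at this
      exact this.trans huniv
    | iUnion s hd hs ih =>
      rw [integral_iUnion (fun i => hle _ (hs i)) hd hfi.integrableOn]
      simp [ih]
  refine (ae_eq_condExp_of_forall_setIntegral_eq (g := 0) hle hfi
    (fun _ _ _ => integrableOn_zero) (fun A hA _ => ?_) aestronglyMeasurable_zero).symm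
  simpa using (hset A hA).symm

end Box

/-- `G_k(f) > 0` iff the conditional expectation of `f` on `𝓑_{k,k-1}` is not a.e. zero. -/
theorem gowersBox_pos_iff_condexp_ne_zero {X : Type*} [MeasurableSpace X]
    (μ : Measure X) [IsProbabilityMeasure μ] (k : ℕ) (hk : 1 ≤ k)
    (f : (Fin k → X) → ℝ) (hf : Measurable f) (hbdd : ∃ C : ℝ, ∀ x, |f x| ≤ C) :
    0 < gowersBox μ k f ↔
      ¬ ((Measure.pi fun _ => μ)[f|boxSigmaAlgebra X k]
          =ᵐ[(Measure.pi fun _ => μ)] (0 : (Fin k → X) → ℝ)) := by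
  have hfb : IsBoundedMeasurable f := ⟨hf, hbdd⟩
  refine ⟨fun h h₀ => h.ne' (gowersBox_eq_zero_of_condExp_eq_zero μ hfb h₀), fun h => ?_⟩
  by_contra h₀
  exact h (condExp_eq_zero_of_gowersBox_nonpos μ hk hfb (not_lt.1 h₀))
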